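/- Let k ≥ 0 and k+1 ≤ l ≤ n+k. The number of parking functions α of length n with n+k spaces satisfying a_1 = l, τ_α = l − h_α, n_α = 1 and h_α = k equals the number of parking functions β of length n with n+k+1 spaces whose first entry is n+k+1 and whose largest empty space m_β equals l. -/

import Mathlib

/-- One parking step: a car with preference `a` parks in the first unoccupied
space `j` with `a ≤ j ≤ m`, if such a space exists; otherwise it leaves. -/
def parkStep (m : ℕ) (occ : Finset ℕ) (a : ℕ) : Finset ℕ :=
  if h : ((Finset.Icc a m) \ occ).Nonempty then
    insert (((Finset.Icc a m) \ occ).min' h) occ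
  else occ

/-- The set of occupied spaces after the cars with preference list `l`
(in order of arrival) have tried to park among spaces `1, …, m`. -/
def occupied (m : ℕ) (l : List ℕ) : Finset ℕ := l.foldl (parkStep m) ∅

/-- The number of cars that leave unparked. -/
def flaws (m : ℕ) (l : List ℕ) : ℕ := l.length - (occupied m l).card

/-- The preference list (with entries in `[1, s]`) encoded by a function `Fin n → Fin s`. -/
def prefList {n s : ℕ} (f : Fin n → Fin s) : List ℕ :=
  (List.ofFn f).map (fun i => (i : ℕ) + 1)

/-- `p n m s k` is the number of `k`-flaw preference sets of length `n` with `m`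
parking spaces, all of whose entries are at most `s`. -/
def p (n m s k : ℕ) : ℕ :=
  (Finset.univ.filter (fun f : Fin n → Fin s => flaws m (prefList f) = k)).card

/-- `pL n m s k l` is the number of `k`-flaw preference sets of length `n` with `m`
parking spaces, entries at most `s`, and first entry `l`. -/
def pL (n m s k l : ℕ) : ℕ :=
  (Finset.univ.filter (fun f : Fin n → Fin s =>
    flaws m (prefList f) = k ∧ (prefList f).head? = some l)).card

/-- The set of empty spaces. -/
def empties (m : ℕ) (l : List ℕ) : Finset ℕ := Finset.Icc 1 m \ occupied m l

/-- `n_α`: the number of entries equal to the first entry. -/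
def nstat (l : List ℕ) : ℕ := l.count l.headI

/-- `h_α`: the number of empty spaces smaller than the first entry. -/
def hstat (m : ℕ) (l : List ℕ) : ℕ := ((empties m l).filter (fun x => x < l.headI)).card

/-- `τ_α`: the number of entries smaller than the first entry, plus one. -/
def taustat (l : List ℕ) : ℕ := l.countP (fun a => a < l.headI) + 1

/-- `m_α`: the largest empty space. -/
def mstat (m : ℕ) (l : List ℕ) : ℕ := (empties m l).sup id

theorem parkStep_cases (m : ℕ) (occ : Finset ℕ) (a : ℕ) :
    (parkStep m occ a = occ ∧ ∀ j, a ≤ j → j ≤ m → j ∈ occ) ∨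
    (∃ j, a ≤ j ∧ j ≤ m ∧ j ∉ occ ∧ (∀ i, a ≤ i → i < j → i ∈ occ) ∧
      parkStep m occ a = insert j occ) := by
  unfold parkStep
  split_ifs with h
  · right
    have hm := Finset.min'_mem _ h
    set j := ((Finset.Icc a m) \ occ).min' h with hj
    simp only [Finset.mem_sdiff, Finset.mem_Icc] at hm
    refine ⟨j, hm.1.1, hm.1.2, hm.2, ?_, rfl⟩
    intro i hi hij
    by_contra hc
    have : j ≤ i := Finset.min'_le _ _ (by
      simp only [Finset.mem_sdiff, Finset.mem_Icc]; exact ⟨⟨hi, by omega⟩, hc⟩)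
    omega
  · left
    refine ⟨rfl, fun j h1 h2 => ?_⟩
    by_contra hc
    exact h ⟨j, by simp only [Finset.mem_sdiff, Finset.mem_Icc]; exact ⟨⟨h1, h2⟩, hc⟩⟩

theorem parkStep_eq (m : ℕ) (occ : Finset ℕ) (a j : ℕ) (h1 : a ≤ j) (h2 : j ≤ m)
    (h3 : j ∉ occ) (h4 : ∀ i, a ≤ i → i < j → i ∈ occ) : parkStep m occ a = insert j occ := by
  rcases parkStep_cases m occ a with ⟨_, h⟩ | ⟨j', g1, g2, g3, g4, g5⟩
  · exact absurd (h j h1 h2) h3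
  · have : j' = j := by
      rcases lt_trichotomy j' j with h | h | h
      · exact absurd (h4 _ g1 h) g3
      · exact h
      · exact absurd (g4 _ h1 h) h3
    rw [g5, this]

/-- Evolution in which no car prefers `l` or crosses `l`. -/
inductive ParkPath (N l : ℕ) : Finset ℕ → List ℕ → Finset ℕ → Prop
  | nil (X : Finset ℕ) : ParkPath N l X [] X
  | cons (X Y : Finset ℕ) (a j : ℕ) (t : List ℕ) (h1 : a ≤ j) (h2 : j ≤ N) (h3 : j ∉ X)
      (h4 : j ≠ l) (h5 : ∀ i, a ≤ i → i < j → i ∈ X ∧ i ≠ l)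
      (h : ParkPath N l (insert j X) t Y) : ParkPath N l X (a :: t) Y

theorem ParkPath.props {N l : ℕ} {X Y : Finset ℕ} {t : List ℕ} (h : ParkPath N l X t Y)
    (hlN : l ≤ N) (hl : l ∉ X) (hN : N + 1 ∉ X) :
    List.foldl (parkStep N) (insert l X) t = insert l Y ∧
    List.foldl (parkStep (N + 1)) (insert (N + 1) X) t = insert (N + 1) Y ∧
    l ∉ Y ∧ N + 1 ∉ Y ∧ Y.card = X.card + t.length ∧
    (Y.filter (· < l)).card = (X.filter (· < l)).card + t.countP (fun a => a < l) ∧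
    l ∉ t ∧ (∀ a ∈ t, a ≤ N) ∧
    ((∀ x ∈ X, 1 ≤ x ∧ x ≤ N) → (∀ a ∈ t, 1 ≤ a) → ∀ x ∈ Y, 1 ≤ x ∧ x ≤ N) := by
  induction h with
  | nil X => simp [hl, hN]
  | cons X Y a j t h1 h2 h3 h4 h5 h ih =>
    have hal : a ≠ l := by
      rintro rfl
      rcases Nat.lt_or_ge a j with h | h
      · exact (h5 a le_rfl h).2 rfl
      · omega
    have hcross : a < l ↔ j < l := by
      constructor
      · intro hh
        by_contra hc
        exact (h5 l hh.le (by omega)).2 rfl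
      · omega
    obtain ⟨i1, i2, i3, i4, i5, i6, i7, i8, i9⟩ := ih (by simp [hl, Ne.symm h4])
      (by simp [hN]; omega)
    refine ⟨?_, ?_, i3, i4, ?_, ?_, ?_, ?_, ?_⟩
    · rw [List.foldl_cons, parkStep_eq N (insert l X) a j h1 h2 (by simp [h3, h4])
        (fun i a b => by simp [(h5 i a b).1]), Finset.insert_comm, i1]
    · rw [List.foldl_cons, parkStep_eq (N+1) (insert (N+1) X) a j h1 (by omega)
        (by simp [h3]; omega)
        (fun i a b => by simp [(h5 i a b).1]), Finset.insert_comm, i2]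
    · rw [i5, Finset.card_insert_of_notMem h3, List.length_cons]; omega
    · rw [i6, Finset.filter_insert, List.countP_cons]
      by_cases hj : j < l
      · rw [if_pos hj, Finset.card_insert_of_notMem (by simp [h3])]
        simp [hcross.2 hj]; omega
      · have : ¬ a < l := fun h => hj (hcross.1 h)
        simp [hj, this]
    · simp [i7, Ne.symm hal]
    · intro b hb
      rcases List.mem_cons.1 hb with rfl | hb
      · omega
      · exact i8 b hb
    · intro hX ht
      apply i9
      · intro x hx
        rcases Finset.mem_insert.1 hx with rfl | hx
        · have := ht a (by simp)
          omega
        · exact hX x hx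
      · intro b hb; exact ht b (by simp [hb])

theorem fold_card (m : ℕ) (t : List ℕ) (X : Finset ℕ) :
    (List.foldl (parkStep m) X t).card ≤ X.card + t.length := by
  induction t generalizing X with
  | nil => simp
  | cons a t ih =>
    have := ih (parkStep m X a)
    rw [List.foldl_cons, List.length_cons]
    rcases parkStep_cases m X a with ⟨h, _⟩ | ⟨j, _, _, _, _, h⟩
    · rw [h] at this ⊢; omega
    · have h2 := Finset.card_insert_le j X
      rw [h] at this ⊢; omega

theorem fold_mono (m : ℕ) (t : List ℕ) (X : Finset ℕ) :
    X ⊆ List.foldl (parkStep m) X t := by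
  induction t generalizing X with
  | nil => simp
  | cons a t ih =>
    rw [List.foldl_cons]
    refine Finset.Subset.trans ?_ (ih _)
    rcases parkStep_cases m X a with ⟨h, _⟩ | ⟨j, _, _, _, _, h⟩ <;> rw [h]
    exact Finset.subset_insert _ _

theorem fold_range (m : ℕ) (t : List ℕ) (X : Finset ℕ) (hX : ∀ x ∈ X, 1 ≤ x ∧ x ≤ m)
    (ht : ∀ a ∈ t, 1 ≤ a) : ∀ x ∈ List.foldl (parkStep m) X t, 1 ≤ x ∧ x ≤ m := by
  induction t generalizing X with
  | nil => simpa using hX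
  | cons a t ih =>
    rw [List.foldl_cons]
    refine ih _ ?_ (fun b hb => ht b (by simp [hb]))
    have := ht a (by simp)
    rcases parkStep_cases m X a with ⟨h, _⟩ | ⟨j, _, _, _, _, h⟩ <;> rw [h]
    · exact hX
    · intro x hx
      rcases Finset.mem_insert.1 hx with rfl | hx
      · omega
      · exact hX x hx

theorem fold_filter (m l : ℕ) (t : List ℕ) (X : Finset ℕ) :
    ((List.foldl (parkStep m) X t).filter (· < l)).card ≤
      (X.filter (· < l)).card + t.countP (fun a => a < l) := by
  induction t generalizing X with
  | nil => simp
  | cons a t ih =>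
    have := ih (parkStep m X a)
    rw [List.foldl_cons, List.countP_cons]
    rcases parkStep_cases m X a with ⟨h, _⟩ | ⟨j, h1, _, _, _, h⟩
    · rw [h] at this ⊢; omega
    · rw [h] at this ⊢
      rw [Finset.filter_insert] at this
      by_cases hj : j < l
      · have h2 := Finset.card_insert_le j (X.filter (· < l))
        have : a < l := by omega
        simp only [hj, if_true, this, decide_true] at *
        omega
      · simp only [hj, if_false] at this
        omega

theorem path_of_A (N l : ℕ) (t : List ℕ) (X : Finset ℕ) (hl : l ∉ X)
    (hc : X.card + 1 + t.length ≤ (List.foldl (parkStep N) (insert l X) t).card)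
    (hf : (X.filter (· < l)).card + t.countP (fun a => a < l) ≤
      ((List.foldl (parkStep N) (insert l X) t).filter (· < l)).card)
    (hlt : l ∉ t) : ∃ Y, ParkPath N l X t Y := by
  induction t generalizing X with
  | nil => exact ⟨X, ParkPath.nil X⟩
  | cons a t ih =>
    rw [List.foldl_cons] at hc hf
    rw [List.countP_cons] at hf
    rw [List.length_cons] at hc
    have hlt' : a ≠ l ∧ l ∉ t := by
      simp only [List.mem_cons, not_or] at hlt
      exact ⟨Ne.symm hlt.1, hlt.2⟩
    rcases parkStep_cases N (insert l X) a with ⟨h, _⟩ | ⟨j, h1, h2, h3, h4, h⟩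
    · exfalso
      rw [h] at hc
      have := fold_card N t (insert l X)
      have := Finset.card_insert_le l X
      omega
    · rw [h] at hc hf
      simp only [Finset.mem_insert, not_or] at h3
      have hcross : a < l → j < l := by
        intro hal
        by_contra hj
        have := fold_filter N l t (insert j (insert l X))
        rw [Finset.filter_insert, if_neg hj, Finset.filter_insert, if_neg (lt_irrefl l)] at this
        simp only [hal, decide_true, if_true] at hf
        omega
      rw [Finset.insert_comm] at hc hf
      obtain ⟨Y, hY⟩ := ih (insert j X) (by simp [hl, Ne.symm h3.1])
        (by rw [Finset.card_insert_of_notMem h3.2]; omega)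
        (by
          rw [Finset.filter_insert]
          by_cases hj : j < l
          · have : a < l := by omega
            rw [if_pos hj, Finset.card_insert_of_notMem (by simp [h3])]
            simp only [this, decide_true, if_true] at hf
            omega
          · rw [if_neg hj]; omega)
        hlt'.2
      refine ⟨Y, ParkPath.cons X Y a j t h1 h2 h3.2 h3.1 ?_ hY⟩
      intro i hi hij
      have hil : i ≠ l := by
        rintro rfl
        have := hcross (by omega)
        omega
      have := h4 i hi hij
      simp only [Finset.mem_insert, hil, false_or] at this
      exact ⟨this, hil⟩

theorem path_of_B (N l : ℕ) (t : List ℕ) (X : Finset ℕ) (hN : N + 1 ∉ X)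
    (hc : X.card + 1 + t.length ≤
      (List.foldl (parkStep (N + 1)) (insert (N + 1) X) t).card)
    (hf : l ∉ List.foldl (parkStep (N + 1)) (insert (N + 1) X) t) :
    ∃ Y, ParkPath N l X t Y := by
  induction t generalizing X with
  | nil => exact ⟨X, ParkPath.nil X⟩
  | cons a t ih =>
    rw [List.foldl_cons] at hc hf
    rw [List.length_cons] at hc
    rcases parkStep_cases (N + 1) (insert (N + 1) X) a with ⟨h, _⟩ | ⟨j, h1, h2, h3, h4, h⟩
    · exfalso
      rw [h] at hc
      have := fold_card (N + 1) t (insert (N + 1) X)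
      have := Finset.card_insert_le (N + 1) X
      omega
    · rw [h] at hc hf
      simp only [Finset.mem_insert, not_or] at h3
      have hl' : l ∉ insert j (insert (N + 1) X) := fun hh => hf (fold_mono _ _ _ hh)
      simp only [Finset.mem_insert, not_or] at hl'
      rw [Finset.insert_comm] at hc hf
      obtain ⟨Y, hY⟩ := ih (insert j X) (by simp [hN, Ne.symm h3.1])
        (by rw [Finset.card_insert_of_notMem h3.2]; omega) hf
      refine ⟨Y, ParkPath.cons X Y a j t h1 (by omega) h3.2 (Ne.symm hl'.1) ?_ hY⟩
      intro i hi hij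
      have := h4 i hi hij
      have hiN : i ≠ N + 1 := by omega
      simp only [Finset.mem_insert, hiN, false_or] at this
      exact ⟨this, fun e => hl'.2.2 (e ▸ this)⟩

theorem card_below (N l : ℕ) (hlN : l ≤ N) (hl1 : 1 ≤ l) (Z : Finset ℕ)
    (hZ : ∀ x ∈ Z, 1 ≤ x ∧ x ≤ N) :
    ((Finset.Icc 1 N \ Z).filter (· < l)).card + (Z.filter (· < l)).card + 1 = l := by
  rw [← Finset.card_union_of_disjoint]
  · have : (Finset.Icc 1 N \ Z).filter (· < l) ∪ Z.filter (· < l) = Finset.Ico 1 l := by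
      ext x
      simp only [Finset.mem_union, Finset.mem_filter, Finset.mem_sdiff, Finset.mem_Icc,
        Finset.mem_Ico]
      have := hZ x
      by_cases hx : x ∈ Z
      · have := this hx; simp only [hx]; grind
      · simp only [hx]; grind
    rw [this, Nat.card_Ico]; omega
  · rw [Finset.disjoint_left]
    intro x hx hx2
    simp only [Finset.mem_filter, Finset.mem_sdiff] at hx hx2
    exact hx.1.2 hx2.1

def condC (N l k : ℕ) (t : List ℕ) : Prop :=
  ∃ Y, ParkPath N l ∅ t Y ∧ (Y.filter (· < l)).card + k + 1 = l

theorem occ_A (N l : ℕ) (hlN : l ≤ N) (hl1 : 1 ≤ l) (t : List ℕ) :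
    occupied N (l :: t) = List.foldl (parkStep N) (insert l ∅) t := by
  rw [occupied, List.foldl_cons, parkStep_eq N ∅ l l le_rfl hlN (by simp)]
  intro i h1 h2; omega

theorem A_iff (N l k : ℕ) (hl1 : k + 1 ≤ l) (hl2 : l ≤ N) (t : List ℕ)
    (ht : ∀ a ∈ t, 1 ≤ a) :
    (flaws N (l :: t) = 0 ∧ taustat (l :: t) = l - hstat N (l :: t) ∧
      nstat (l :: t) = 1 ∧ hstat N (l :: t) = k) ↔ condC N l k t := by
  have hocc := occ_A N l hl2 (by omega) t
  have htau : taustat (l :: t) = t.countP (fun a => a < l) + 1 := by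
    simp [taustat]
    try rfl
  have hns : nstat (l :: t) = 1 ↔ l ∉ t := by
    simp [nstat, List.count_eq_zero]
  have hr := fold_range N t (insert l ∅) (by simp; omega) ht
  have hcb := card_below N l hl2 (by omega) _ hr
  have hh : hstat N (l :: t) = ((Finset.Icc 1 N \
      List.foldl (parkStep N) (insert l ∅) t).filter (· < l)).card := by
    rw [hstat, empties, hocc]; rfl
  rw [← hh] at hcb
  rw [htau, hns, flaws, hocc, List.length_cons]
  constructor
  · rintro ⟨h1, h2, h3, h4⟩
    obtain ⟨Y, hY⟩ := path_of_A N l t ∅ (by simp) (by simp; simp at h1; omega)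
      (by simp; simp at hcb; omega) h3
    refine ⟨Y, hY, ?_⟩
    obtain ⟨i1, i2, i3, i4, i5, i6, i7, i8, i9⟩ := hY.props hl2 (by simp) (by simp)
    simp at i6
    omega
  · rintro ⟨Y, hY, hk⟩
    obtain ⟨i1, i2, i3, i4, i5, i6, i7, i8, i9⟩ := hY.props hl2 (by simp) (by simp)
    rw [i1] at hcb ⊢
    rw [Finset.filter_insert, if_neg (lt_irrefl l)] at hcb
    rw [Finset.card_insert_of_notMem i3]
    simp at i5 i6
    refine ⟨by omega, by omega, i7, by omega⟩

theorem occ_B (N : ℕ) (t : List ℕ) :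
    occupied (N + 1) ((N + 1) :: t) = List.foldl (parkStep (N + 1)) (insert (N + 1) ∅) t :=
  occ_A (N + 1) (N + 1) le_rfl (by omega) t

theorem sup_iff (N l : ℕ) (Y : Finset ℕ) (hl1 : 1 ≤ l) (hl2 : l ≤ N) (hlY : l ∉ Y) :
    (Finset.Icc 1 (N + 1) \ insert (N + 1) Y).sup id = l ↔ Finset.Icc (l + 1) N ⊆ Y := by
  constructor
  · intro h x hx
    rw [Finset.mem_Icc] at hx
    by_contra hc
    have := Finset.le_sup (f := id) (s := Finset.Icc 1 (N + 1) \ insert (N + 1) Y) (b := x)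
      (by simp [hc]; omega)
    rw [h] at this
    simp at this; omega
  · intro h
    apply le_antisymm
    · apply Finset.sup_le
      intro x hx
      simp only [Finset.mem_sdiff, Finset.mem_Icc, Finset.mem_insert, not_or] at hx
      by_contra hc
      simp at hc
      exact hx.2.2 (h (by simp; omega))
    · exact Finset.le_sup (f := id) (s := Finset.Icc 1 (N + 1) \ insert (N + 1) Y) (b := l)
        (by simp [hlY]; omega)

theorem card_split (N l : ℕ) (Y : Finset ℕ) (hlY : l ∉ Y)
    (hY : ∀ x ∈ Y, 1 ≤ x ∧ x ≤ N) (hl2 : l ≤ N) :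
    Finset.Icc (l + 1) N ⊆ Y ↔ Y.card = (Y.filter (· < l)).card + (N - l) := by
  have hs : (Y.filter (· < l)).card + (Y.filter (fun x => ¬ x < l)).card = Y.card :=
    Finset.card_filter_add_card_filter_not _
  have hsub : Y.filter (fun x => ¬ x < l) ⊆ Finset.Icc (l + 1) N := by
    intro x hx
    simp only [Finset.mem_filter, Finset.mem_Icc] at hx ⊢
    have := hY x hx.1
    have : x ≠ l := fun e => hlY (e ▸ hx.1)
    omega
  have hcard : (Finset.Icc (l + 1) N).card = N - l := by simp
  constructor
  · intro h
    have : Y.filter (fun x => ¬ x < l) = Finset.Icc (l + 1) N := by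
      apply Finset.Subset.antisymm hsub
      intro x hx
      have := h hx
      simp only [Finset.mem_filter, Finset.mem_Icc] at hx ⊢
      exact ⟨this, by omega⟩
    rw [this, hcard] at hs
    omega
  · intro h
    have := Finset.eq_of_subset_of_card_le hsub (by omega)
    rw [← this]
    exact Finset.filter_subset _ _

theorem B_iff (N l k : ℕ) (hl1 : k + 1 ≤ l) (hl2 : l ≤ N) (t : List ℕ)
    (ht : ∀ a ∈ t, 1 ≤ a) (hlen : t.length + 1 + k = N) :
    (flaws (N + 1) ((N + 1) :: t) = 0 ∧ mstat (N + 1) ((N + 1) :: t) = l) ↔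
      condC N l k t := by
  have hocc := occ_B N t
  rw [flaws, mstat, empties, hocc, List.length_cons]
  have key : ∀ Y, ParkPath N l ∅ t Y →
      (((Finset.Icc 1 (N + 1) \ insert (N + 1) Y).sup id = l) ↔
        (Y.filter (· < l)).card + k + 1 = l) := by
    intro Y hY
    obtain ⟨i1, i2, i3, i4, i5, i6, i7, i8, i9⟩ := hY.props hl2 (by simp) (by simp)
    rw [sup_iff N l Y (by omega) hl2 i3, card_split N l Y i3 (i9 (by simp) ht) hl2]
    simp at i5
    omega
  constructor
  · rintro ⟨h1, h2⟩
    have hmem : l ∉ List.foldl (parkStep (N + 1)) (insert (N + 1) ∅) t := by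
      intro hc
      set S := Finset.Icc 1 (N + 1) \ List.foldl (parkStep (N + 1)) (insert (N + 1) ∅) t
      have hS : S.Nonempty := by
        by_contra hh
        rw [Finset.not_nonempty_iff_eq_empty] at hh
        rw [hh] at h2
        simp at h2; omega
      obtain ⟨x, hx, hxe⟩ := Finset.exists_mem_eq_sup S hS id
      rw [h2] at hxe
      simp only [id] at hxe
      subst hxe
      exact (Finset.mem_sdiff.1 hx).2 hc
    obtain ⟨Y, hY⟩ := path_of_B N l t ∅ (by simp) (by simp; simp at h1; omega) hmem
    have hp := hY.props hl2 (by simp) (by simp)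
    rw [hp.2.1] at h2
    exact ⟨Y, hY, (key Y hY).1 h2⟩
  · rintro ⟨Y, hY, hk⟩
    obtain ⟨i1, i2, i3, i4, i5, i6, i7, i8, i9⟩ := hY.props hl2 (by simp) (by simp)
    rw [i2, Finset.card_insert_of_notMem i4]
    simp at i5
    exact ⟨by omega, (key Y hY).2 hk⟩

theorem condC_le {N l k : ℕ} {t : List ℕ} (hl2 : l ≤ N) (h : condC N l k t) :
    ∀ a ∈ t, a ≤ N := by
  obtain ⟨Y, hY, _⟩ := h
  exact (hY.props hl2 (by simp) (by simp)).2.2.2.2.2.2.2.1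

theorem prefList_eq {n s : ℕ} (f : Fin n → Fin s) :
    prefList f = List.ofFn (fun i => (f i : ℕ) + 1) := by
  have h : ∀ L : List (Fin s), List.flatMap (fun a : Fin s => [(a : ℕ)]) L =
      List.map (fun a : Fin s => (a : ℕ)) L := by
    intro L
    induction L with
    | nil => rfl
    | cons a L ih => rw [List.flatMap_cons, ih]; rfl
  have h2 : prefList f = (List.flatMap (fun a : Fin s => [(a : ℕ)]) (List.ofFn f)).map
      (fun i => i + 1) := by
    simp [prefList]
  rw [h2, h, List.map_map, List.map_ofFn]
  rfl

theorem prefList_pos {n s : ℕ} (f : Fin n → Fin s) : ∀ a ∈ prefList f, 1 ≤ a := by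
  intro a ha
  rw [prefList_eq, List.mem_ofFn] at ha
  obtain ⟨i, rfl⟩ := ha
  omega

theorem prefList_length {n s : ℕ} (f : Fin n → Fin s) : (prefList f).length = n := by
  simp [prefList_eq]

theorem prefList_succ {n s : ℕ} (f : Fin (n + 1) → Fin s) :
    prefList f = ((f 0 : ℕ) + 1) :: prefList (fun i => f i.succ) := by
  simp [prefList_eq, List.ofFn_succ]

theorem prefList_castSucc {n s : ℕ} (f : Fin n → Fin s) :
    prefList (fun i => (f i).castSucc) = prefList f := by
  simp [prefList_eq]

theorem filt_A (n k l : ℕ) (hl1 : k + 1 ≤ l) (hl2 : l ≤ n + 1 + k)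
    (f : Fin (n + 1) → Fin (n + 1 + k)) :
    (flaws (n + 1 + k) (prefList f) = 0 ∧ (prefList f).head? = some l ∧
        taustat (prefList f) = l - hstat (n + 1 + k) (prefList f) ∧
        nstat (prefList f) = 1 ∧ hstat (n + 1 + k) (prefList f) = k) ↔
    ((f 0 : ℕ) + 1 = l ∧ condC (n + 1 + k) l k (prefList (fun i => f i.succ))) := by
  rw [← A_iff (n + 1 + k) l k hl1 hl2 _ (prefList_pos _), prefList_succ f]
  simp only [List.head?_cons, Option.some.injEq]
  constructor
  · rintro ⟨h1, h2, h3⟩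
    rw [h2] at h1 h3
    exact ⟨h2, h1, h3⟩
  · rintro ⟨h2, h1, h3⟩
    rw [h2]
    exact ⟨h1, rfl, h3⟩

theorem filt_B (n k l : ℕ) (hl1 : k + 1 ≤ l) (hl2 : l ≤ n + 1 + k)
    (f : Fin (n + 1) → Fin (n + 1 + k + 1)) :
    (flaws (n + 1 + k + 1) (prefList f) = 0 ∧
        (prefList f).head? = some (n + 1 + k + 1) ∧
        mstat (n + 1 + k + 1) (prefList f) = l) ↔
    ((f 0 : ℕ) + 1 = n + 1 + k + 1 ∧
      condC (n + 1 + k) l k (prefList (fun i => f i.succ))) := by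
  rw [← B_iff (n + 1 + k) l k hl1 hl2 _ (prefList_pos _) (by rw [prefList_length]),
    prefList_succ f]
  simp only [List.head?_cons, Option.some.injEq]
  constructor
  · rintro ⟨h1, h2, h3⟩
    rw [h2] at h1 h3
    exact ⟨h2, h1, h3⟩
  · rintro ⟨h2, h1, h3⟩
    rw [h2]
    exact ⟨h1, rfl, h3⟩

/-- Lemma 3.4: for `k ≥ 0` and `k+1 ≤ l ≤ n+k`, the number of parking functions `α`
of length `n` with `n+k` spaces such that `a₁ = l`, `τ_α = l - h_α`, `n_α = 1` and
`h_α = k` equals the number of parking functions `β` of length `n` with `n+k+1` spaces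
with first entry `n+k+1` and largest empty space `m_β = l`. -/
theorem stmt7 (n k l : ℕ) (hn : 1 ≤ n) (hl1 : k + 1 ≤ l) (hl2 : l ≤ n + k) :
    (Finset.univ.filter (fun f : Fin n → Fin (n + k) =>
        flaws (n + k) (prefList f) = 0 ∧ (prefList f).head? = some l ∧
        taustat (prefList f) = l - hstat (n + k) (prefList f) ∧
        nstat (prefList f) = 1 ∧ hstat (n + k) (prefList f) = k)).card =
      (Finset.univ.filter (fun f : Fin n → Fin (n + k + 1) =>
        flaws (n + k + 1) (prefList f) = 0 ∧ (prefList f).head? = some (n + k + 1) ∧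
        mstat (n + k + 1) (prefList f) = l)).card := by
  obtain ⟨n, rfl⟩ : ∃ n', n = n' + 1 := ⟨n - 1, by omega⟩
  refine Finset.card_bij
    (fun f _ => Fin.cons (Fin.last (n + 1 + k)) (fun i => (f i.succ).castSucc)) ?_ ?_ ?_
  · intro f hf
    simp only [Finset.mem_filter, Finset.mem_univ, true_and] at hf ⊢
    rw [filt_A n k l hl1 hl2] at hf
    rw [filt_B n k l hl1 hl2]
    refine ⟨by simp, ?_⟩
    simp only [Fin.cons_succ]
    rw [prefList_castSucc (fun i => f i.succ)]
    exact hf.2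
  · intro f hf g hg h
    simp only [Finset.mem_filter, Finset.mem_univ, true_and] at hf hg
    rw [filt_A n k l hl1 hl2] at hf hg
    have h2 := (Fin.cons_inj.1 h).2
    funext i
    refine Fin.cases ?_ (fun j => ?_) i
    · apply Fin.ext; omega
    · exact Fin.castSucc_injective _ (congrFun h2 j)
  · intro g hg
    simp only [Finset.mem_filter, Finset.mem_univ, true_and] at hg
    rw [filt_B n k l hl1 hl2] at hg
    obtain ⟨hg0, hgC⟩ := hg
    have hle := condC_le hl2 hgC
    have hlt : ∀ i : Fin n, (g i.succ : ℕ) < n + 1 + k := by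
      intro i
      have := hle ((g i.succ : ℕ) + 1) (by
        rw [prefList_eq, List.mem_ofFn]; exact ⟨i, rfl⟩)
      omega
    have hcast : (fun i : Fin n => (⟨g i.succ, hlt i⟩ : Fin (n + 1 + k)).castSucc) =
        fun i => g i.succ := by
      funext i; rfl
    refine ⟨Fin.cons ⟨l - 1, by omega⟩ (fun i => ⟨g i.succ, hlt i⟩), ?_, ?_⟩
    · simp only [Finset.mem_filter, Finset.mem_univ, true_and]
      rw [filt_A n k l hl1 hl2]
      refine ⟨by simp; omega, ?_⟩
      simp only [Fin.cons_succ]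
      rw [← prefList_castSucc, hcast]
      exact hgC
    · funext i
      refine Fin.cases ?_ (fun j => ?_) i
      · apply Fin.ext; simp; omega
      · simp
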